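/- Let x be the horizontal component of the Peano curve. For every c ∈ (0,1/3] and every r ∈ ℝ: [x]_{1/9}^{c,r} = [x]_{2/9}^{c,r} - [x]_{1/9}^{c,r} = [x]_{3/9}^{c,r} - [x]_{2/9}^{c,r} = (1/9)·[x]_1^{3c,3r}. -/

import Mathlib

open scoped BigOperators Classical
open Filter

noncomputable section

/-- The digit map `k n = 2 - n` on `{0,1,2}` (with truncated natural subtraction). -/
def peanoK : ℕ → ℕ := fun n => 2 - n

/-- The `m`-th (0-indexed) ternary digit of the horizontal component of the Peano curve
evaluated at the point with ternary digits `d` (0-indexed, i.e. `t_j = d (j-1)`):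
the `j`-th digit of `x(t)` is `k^[t_2 + t_4 + ⋯ + t_{2j-2}] (t_{2j-1})`. -/
def peanoXDigit (d : ℕ → Fin 3) (m : ℕ) : ℕ :=
  peanoK^[∑ i ∈ Finset.range m, (d (2 * i + 1) : ℕ)] (d (2 * m) : ℕ)

/-- `x : ℝ → ℝ` is (on `[0,1]`) the horizontal component of the Peano curve:
for every ternary expansion `t = Σ_j d_j 3^{-(j+1)}`, `x t` is given by the digit formula. -/
def IsPeanoX (x : ℝ → ℝ) : Prop :=
  ∀ d : ℕ → Fin 3,
    x (∑' j : ℕ, (d j : ℝ) / 3 ^ (j + 1)) = ∑' m : ℕ, (peanoXDigit d m : ℝ) / 3 ^ (m + 1)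

/-- The grid `cℤ + r = {cq + r : q ∈ ℤ}`. -/
def peanoGrid (c r : ℝ) : Set ℝ := {u : ℝ | ∃ q : ℤ, u = c * q + r}

/-- `lebTime x c r m` is the time `t_{m+1}(c,r)` of the Lebesgue partition `π(c,r)` for `x`
on `[0,1]` (values in `[0,1] ∪ {+∞}`, modelled in `EReal`; `sInf ∅ = ⊤ = +∞`). -/
def lebTime (x : ℝ → ℝ) (c r : ℝ) : ℕ → EReal
  | 0 => sInf (Real.toEReal '' {t : ℝ | t ∈ Set.Icc (0 : ℝ) 1 ∧ x t ∈ peanoGrid c r})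
  | m + 1 =>
    if lebTime x c r m = ⊤ then ⊤
    else
      sInf (Real.toEReal ''
        {t : ℝ | t ∈ Set.Icc ((lebTime x c r m).toReal) 1 ∧ x t ∈ peanoGrid c r ∧
          x t ≠ x ((lebTime x c r m).toReal)})

/-- `k(c,r,t) = min{m ∈ ℕ₊ : t_m(c,r) ≥ t}` (recall `t_m(c,r) = lebTime x c r (m-1)`). -/
def kIdx (x : ℝ → ℝ) (c r t : ℝ) : ℕ :=
  sInf {m : ℕ | 1 ≤ m ∧ (t : EReal) ≤ lebTime x c r (m - 1)}

/-- `l(c,r,t) = max{m ∈ ℕ₊ : t_m(c,r) ≤ t}`. -/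
def lIdx (x : ℝ → ℝ) (c r t : ℝ) : ℕ :=
  sSup {m : ℕ | 1 ≤ m ∧ lebTime x c r (m - 1) ≤ (t : EReal)}

/-- The quadratic variation `[x]_{s,t}^{c,r}` of `x` on `[s,t]` along the Lebesgue partition
`π(c,r)`: the sum over `m = k(c,r,s), …, l(c,r,t) - 1` of `(x(t_{m+1}) - x(t_m))²`. -/
def qvar (x : ℝ → ℝ) (c r s t : ℝ) : ℝ :=
  ∑ m ∈ Finset.Ico (kIdx x c r s) (lIdx x c r t),
    (x ((lebTime x c r m).toReal) - x ((lebTime x c r (m - 1)).toReal)) ^ 2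

/-- `[x]_t^{c,r} := [x]_{0,t}^{c,r}`. -/
def qvar0 (x : ℝ → ℝ) (c r t : ℝ) : ℝ := qvar x c r 0 t

/-- The digit `a` if `n` is even and the reflected digit `2 - a` if `n` is odd. -/
def flipDigit (n : ℕ) (a : Fin 3) : Fin 3 := if Even n then a else a.rev

/-- The ternary digits of the horizontal component of the Peano curve, as elements of `Fin 3`. -/
def peanoDigits (d : ℕ → Fin 3) (m : ℕ) : Fin 3 :=
  flipDigit (∑ i ∈ Finset.range m, (d (2 * i + 1) : ℕ)) (d (2 * m))

lemma peanoK_iterate_eq_flipDigit (n : ℕ) (a : Fin 3) :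
    peanoK^[n] (a : ℕ) = (flipDigit n a : ℕ) := by
  induction n with
  | zero => simp [flipDigit]
  | succ n ih =>
    rw [Function.iterate_succ_apply', ih]
    by_cases h : Even n
    · simp [flipDigit, h, Nat.even_add_one, peanoK, Fin.rev]
    · simp only [flipDigit, h, Nat.even_add_one, peanoK, Fin.rev]
      simp
      omega

lemma flipDigit_add (b n : ℕ) (a : Fin 3) :
    flipDigit (b + n) a = flipDigit b (flipDigit n a) := by
  by_cases hb : Even b <;> by_cases hn : Even n <;> simp [flipDigit, hb, hn, Nat.even_add]

lemma IsPeanoX.apply_ofDigits {x : ℝ → ℝ} (hx : IsPeanoX x) (d : ℕ → Fin 3) :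
    x (Real.ofDigits d) = Real.ofDigits (peanoDigits d) := by
  have h := hx d
  simp only [peanoXDigit, peanoK_iterate_eq_flipDigit] at h
  simpa [Real.ofDigits, Real.ofDigitsTerm, peanoDigits, div_eq_mul_inv] using h

lemma ofDigits_rev (d : ℕ → Fin 3) :
    Real.ofDigits (fun i => (d i).rev) = 1 - Real.ofDigits d := by
  rw [eq_sub_iff_add_eq, ← Real.ofDigits_const_last_eq_one 2, Real.ofDigits, Real.ofDigits,
    Real.ofDigits,
    ← Summable.tsum_add Real.summable_ofDigitsTerm Real.summable_ofDigitsTerm]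
  congr 1
  ext i
  simp only [Real.ofDigitsTerm, ← add_mul]
  congr 1
  have : (((d i).rev : ℕ) + (d i : ℕ)) = 2 := by rw [Fin.val_rev]; omega
  simpa using (by exact_mod_cast this : (((d i).rev : ℕ) : ℝ) + ((d i : ℕ) : ℝ) = 2)

lemma exists_ofDigits_eq {t : ℝ} (ht : t ∈ Set.Icc (0 : ℝ) 1) :
    ∃ d : ℕ → Fin 3, Real.ofDigits d = t := by
  obtain ⟨d, -, hd⟩ := Real.ofDigits_SurjOn (b := 3) (by norm_num) ht
  exact ⟨d, hd⟩

lemma IsPeanoX.apply_one_sub {x : ℝ → ℝ} (hx : IsPeanoX x) {t : ℝ}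
    (ht : t ∈ Set.Icc (0 : ℝ) 1) : x (1 - t) = 1 - x t := by
  obtain ⟨d, rfl⟩ := exists_ofDigits_eq ht
  rw [← ofDigits_rev, hx.apply_ofDigits, hx.apply_ofDigits, ← ofDigits_rev]
  congr 1
  ext m
  have h : Even (∑ i ∈ Finset.range m, ((d (2 * i + 1)).rev : ℕ)) ↔
      Even (∑ i ∈ Finset.range m, (d (2 * i + 1) : ℕ)) := by
    rw [← Nat.even_add, ← Finset.sum_add_distrib]
    refine Finset.even_sum _ fun i _ => ⟨1, ?_⟩
    rw [Fin.val_rev]; omega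
  simp only [peanoDigits, flipDigit, h]
  split_ifs <;> rfl

/-- The digit sequence `0, b, d 0, d 1, …`. -/
def consTwo (b : Fin 3) (d : ℕ → Fin 3) : ℕ → Fin 3
  | 0 => 0
  | 1 => b
  | n + 2 => d n

lemma peanoDigits_consTwo_succ (b : Fin 3) (d : ℕ → Fin 3) (m : ℕ) :
    peanoDigits (consTwo b d) (m + 1) = flipDigit b (peanoDigits d m) := by
  simp only [peanoDigits, Finset.sum_range_succ']
  rw [add_comm, flipDigit_add]
  rfl

lemma ofDigits_consTwo (b : Fin 3) (d : ℕ → Fin 3) :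
    Real.ofDigits (consTwo b d) = ((b : ℕ) + Real.ofDigits d) / 9 := by
  rw [Real.ofDigits_eq_sum_add_ofDigits _ 2]
  simp [Finset.sum_range_succ, Real.ofDigitsTerm, consTwo]
  ring

lemma IsPeanoX.apply_first_ninths {x : ℝ → ℝ} (hx : IsPeanoX x) (b : Fin 3) (d : ℕ → Fin 3) :
    x (((b : ℕ) + Real.ofDigits d) / 9) =
      Real.ofDigits (fun m => flipDigit b (peanoDigits d m)) / 3 := by
  rw [← ofDigits_consTwo, hx.apply_ofDigits, Real.ofDigits_eq_sum_add_ofDigits _ 1]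
  simp only [peanoDigits_consTwo_succ]
  simp [Real.ofDigitsTerm, peanoDigits, flipDigit, consTwo]
  ring

lemma IsPeanoX.apply_div_nine {x : ℝ → ℝ} (hx : IsPeanoX x) {t : ℝ}
    (ht : t ∈ Set.Icc (0 : ℝ) 1) : x (t / 9) = x t / 3 := by
  obtain ⟨d, rfl⟩ := exists_ofDigits_eq ht
  simpa [flipDigit, hx.apply_ofDigits] using hx.apply_first_ninths 0 d

lemma IsPeanoX.apply_one_add_div_nine {x : ℝ → ℝ} (hx : IsPeanoX x) {t : ℝ}
    (ht : t ∈ Set.Icc (0 : ℝ) 1) : x ((1 + t) / 9) = (1 - x t) / 3 := by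
  obtain ⟨d, rfl⟩ := exists_ofDigits_eq ht
  simpa [flipDigit, hx.apply_ofDigits, ofDigits_rev] using hx.apply_first_ninths 1 d

lemma IsPeanoX.apply_two_add_div_nine {x : ℝ → ℝ} (hx : IsPeanoX x) {t : ℝ}
    (ht : t ∈ Set.Icc (0 : ℝ) 1) : x ((2 + t) / 9) = x t / 3 := by
  obtain ⟨d, rfl⟩ := exists_ofDigits_eq ht
  simpa [flipDigit, hx.apply_ofDigits] using hx.apply_first_ninths 2 d

lemma IsPeanoX.apply_two_ninths_sub {x : ℝ → ℝ} (hx : IsPeanoX x) {t : ℝ}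
    (ht : t ∈ Set.Icc (0 : ℝ) (1 / 9)) : x (2 / 9 - t) = x t := by
  obtain ⟨h0, h1⟩ := ht
  have h9 : 9 * t ∈ Set.Icc (0 : ℝ) 1 := ⟨by linarith, by linarith⟩
  have h := hx.apply_one_add_div_nine (t := 1 - 9 * t) ⟨by linarith, by linarith⟩
  rw [hx.apply_one_sub h9, sub_sub_cancel, ← hx.apply_div_nine h9] at h
  convert h using 2 <;> ring

lemma IsPeanoX.apply_two_ninths_add {x : ℝ → ℝ} (hx : IsPeanoX x) {t : ℝ}
    (ht : t ∈ Set.Icc (0 : ℝ) (1 / 9)) : x (t + 2 / 9) = x t := by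
  obtain ⟨h0, h1⟩ := ht
  have h9 : 9 * t ∈ Set.Icc (0 : ℝ) 1 := ⟨by linarith, by linarith⟩
  have h := hx.apply_two_add_div_nine h9
  rw [← hx.apply_div_nine h9] at h
  convert h using 2 <;> ring

lemma IsPeanoX.apply_zero {x : ℝ → ℝ} (hx : IsPeanoX x) : x 0 = 0 := by
  have h := hx.apply_div_nine (t := 0) ⟨le_rfl, zero_le_one⟩
  rw [zero_div] at h
  linarith

lemma IsPeanoX.apply_one_ninth {x : ℝ → ℝ} (hx : IsPeanoX x) : x (1 / 9) = 1 / 3 := by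
  have h := hx.apply_one_sub (t := 0) ⟨le_rfl, zero_le_one⟩
  rw [hx.apply_zero, sub_zero] at h
  rw [hx.apply_div_nine ⟨zero_le_one, le_rfl⟩, h]

lemma continuous_peanoDigits : Continuous peanoDigits := by
  refine continuous_pi fun m => ?_
  have h : Continuous fun p : ℕ × Fin 3 => flipDigit p.1 p.2 := continuous_of_discreteTopology
  have hsum : Continuous fun d : ℕ → Fin 3 => ∑ i ∈ Finset.range m, (d (2 * i + 1) : ℕ) := by
    refine continuous_finsetSum _ fun i _ => ?_
    exact (continuous_of_discreteTopology (f := fun a : Fin 3 => (a : ℕ))).comp (continuous_apply _)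
  exact h.comp (hsum.prodMk (continuous_apply (2 * m)))

lemma IsPeanoX.continuousOn {x : ℝ → ℝ} (hx : IsPeanoX x) :
    ContinuousOn x (Set.Icc (0 : ℝ) 1) := by
  let g : (ℕ → Fin 3) → Set.Icc (0 : ℝ) 1 := fun d =>
    ⟨Real.ofDigits d, Real.ofDigits_nonneg d, Real.ofDigits_le_one d⟩
  have hg : Continuous g := Real.continuous_ofDigits.subtype_mk _
  have hs : Function.Surjective g := fun t => by
    obtain ⟨d, hd⟩ := exists_ofDigits_eq t.2
    exact ⟨d, Subtype.ext hd⟩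
  have hq : Topology.IsQuotientMap g := hg.isClosedMap.isQuotientMap hg hs
  rw [continuousOn_iff_continuous_domRestrict, hq.continuous_iff]
  have h : (Set.Icc (0 : ℝ) 1).domRestrict x ∘ g = Real.ofDigits ∘ peanoDigits := by
    ext d
    exact hx.apply_ofDigits d
  rw [h]
  exact Real.continuous_ofDigits.comp continuous_peanoDigits

/-- `IsAltChain f G a b l` says that `l` is a nondecreasing list of points of `[a, b]` at which `f`
takes values in `G`, with different values at consecutive points. -/
def IsAltChain (f : ℝ → ℝ) (G : Set ℝ) (a b : ℝ) (l : List ℝ) : Prop :=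
  l.IsChain (fun s t => s ≤ t ∧ f s ≠ f t) ∧ ∀ s ∈ l, s ∈ Set.Icc a b ∧ f s ∈ G

/-- The lengths of the lists satisfying `IsAltChain f G a b`. -/
def altLengths (f : ℝ → ℝ) (G : Set ℝ) (a b : ℝ) : Set ℕ :=
  {n | ∃ l, IsAltChain f G a b l ∧ l.length = n}

lemma altLengths_subset_of_monotoneOn {f f' φ : ℝ → ℝ} {G G' : Set ℝ} {a b a' b' : ℝ}
    (hφ : MonotoneOn φ (Set.Icc a b))
    (hmaps : ∀ s ∈ Set.Icc a b, f s ∈ G → φ s ∈ Set.Icc a' b' ∧ f' (φ s) ∈ G')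
    (hne : ∀ s ∈ Set.Icc a b, ∀ t ∈ Set.Icc a b, f s ≠ f t → f' (φ s) ≠ f' (φ t)) :
    altLengths f G a b ⊆ altLengths f' G' a' b' := by
  rintro _ ⟨l, ⟨hl, hmem⟩, rfl⟩
  refine ⟨l.map φ, ⟨?_, ?_⟩, by simp⟩
  · rw [List.isChain_map]
    refine hl.imp_of_mem_imp fun s t hs ht h => ⟨?_, ?_⟩
    · exact hφ (hmem s hs).1 (hmem t ht).1 h.1
    · exact hne s (hmem s hs).1 t (hmem t ht).1 h.2
  · intro u hu
    obtain ⟨s, hs, rfl⟩ := List.mem_map.1 hu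
    exact hmaps s (hmem s hs).1 (hmem s hs).2

lemma altLengths_subset_of_antitoneOn {f f' φ : ℝ → ℝ} {G G' : Set ℝ} {a b a' b' : ℝ}
    (hφ : AntitoneOn φ (Set.Icc a b))
    (hmaps : ∀ s ∈ Set.Icc a b, f s ∈ G → φ s ∈ Set.Icc a' b' ∧ f' (φ s) ∈ G')
    (hne : ∀ s ∈ Set.Icc a b, ∀ t ∈ Set.Icc a b, f s ≠ f t → f' (φ s) ≠ f' (φ t)) :
    altLengths f G a b ⊆ altLengths f' G' a' b' := by
  rintro _ ⟨l, ⟨hl, hmem⟩, rfl⟩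
  refine ⟨(l.map φ).reverse, ⟨?_, ?_⟩, by simp⟩
  · rw [List.isChain_reverse, List.isChain_map]
    refine hl.imp_of_mem_imp fun s t hs ht h => ⟨?_, ?_⟩
    · exact hφ (hmem s hs).1 (hmem t ht).1 h.1
    · exact (hne s (hmem s hs).1 t (hmem t ht).1 h.2).symm
  · intro u hu
    obtain ⟨s, hs, rfl⟩ := List.mem_map.1 (List.mem_reverse.1 hu)
    exact hmaps s (hmem s hs).1 (hmem s hs).2

lemma List.Pairwise.exists_append_of_le {l : List ℝ} (hl : l.Pairwise (· ≤ ·)) (b : ℝ) :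
    ∃ l₁ l₂, l = l₁ ++ l₂ ∧ (∀ s ∈ l₁, s ≤ b) ∧ ∀ s ∈ l₂, b ≤ s := by
  induction l with
  | nil => exact ⟨[], [], by simp⟩
  | cons u l ih =>
    rw [List.pairwise_cons] at hl
    by_cases hu : u ≤ b
    · obtain ⟨l₁, l₂, rfl, h₁, h₂⟩ := ih hl.2
      exact ⟨u :: l₁, l₂, rfl, by simpa [hu] using h₁, h₂⟩
    · refine ⟨[], u :: l, rfl, by simp, ?_⟩
      push Not at hu
      simp only [List.mem_cons, forall_eq_or_imp]
      exact ⟨hu.le, fun s hs => hu.le.trans (hl.1 s hs)⟩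

lemma IsAltChain.pairwise_le {f : ℝ → ℝ} {G : Set ℝ} {a b : ℝ} {l : List ℝ}
    (h : IsAltChain f G a b l) : l.Pairwise (· ≤ ·) :=
  (h.1.imp fun _ _ h => h.1).pairwise

lemma IsAltChain.append_singleton {f : ℝ → ℝ} {G : Set ℝ} {a b u τ : ℝ} {l : List ℝ}
    (h : IsAltChain f G a b l) (hτ : IsGreatest {s | s ∈ Set.Icc a b ∧ f s ∈ G} τ)
    (hu : u ∈ l.getLast?) (hne : f u ≠ f τ) : IsAltChain f G a b (l ++ [τ]) := by
  refine ⟨h.1.append (List.isChain_singleton _) ?_, ?_⟩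
  · intro v hv w hw
    obtain rfl : v = u := Option.mem_unique hv hu
    obtain rfl : τ = w := by simpa using hw
    exact ⟨hτ.2 (h.2 _ (List.mem_of_getLast? hv)), hne⟩
  · simp only [List.mem_append, List.mem_singleton]
    rintro s (hs | rfl)
    exacts [h.2 s hs, hτ.1]

lemma IsAltChain.cons {f : ℝ → ℝ} {G : Set ℝ} {a b v σ : ℝ} {l : List ℝ}
    (h : IsAltChain f G a b l) (hσ : IsLeast {s | s ∈ Set.Icc a b ∧ f s ∈ G} σ)
    (hv : v ∈ l.head?) (hne : f σ ≠ f v) : IsAltChain f G a b (σ :: l) := by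
  refine ⟨h.1.cons ?_, ?_⟩
  · intro w hw
    obtain rfl : w = v := Option.mem_unique hw hv
    exact ⟨hσ.2 (h.2 _ (List.mem_of_mem_head? hw)), hne⟩
  · simp only [List.mem_cons]
    rintro s (rfl | hs)
    exacts [hσ.1, h.2 s hs]

/-- If the last visit to `G` before time `b` and the first visit after it have the same value, then
the maximal numbers of changes on `[a, b]` and `[b, c]` add up. -/
lemma isGreatest_altLengths_add {f : ℝ → ℝ} {G : Set ℝ} {a b c τ σ : ℝ} {N₁ N₂ : ℕ}
    (hab : a ≤ b) (hbc : b ≤ c)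
    (hτ : IsGreatest {s | s ∈ Set.Icc a b ∧ f s ∈ G} τ)
    (hσ : IsLeast {s | s ∈ Set.Icc b c ∧ f s ∈ G} σ) (hτσ : f τ = f σ)
    (h₁ : IsGreatest (altLengths f G a b) (N₁ + 1))
    (h₂ : IsGreatest (altLengths f G b c) (N₂ + 1)) :
    IsGreatest (altLengths f G a c) (N₁ + N₂ + 1) := by
  constructor
  · obtain ⟨l₁, hl₁, hlen₁⟩ := h₁.1
    obtain ⟨l₂, hl₂, hlen₂⟩ := h₂.1
    obtain ⟨v, l₂, rfl⟩ := List.exists_cons_of_length_eq_add_one hlen₂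
    refine ⟨l₁ ++ l₂, ⟨hl₁.1.append hl₂.1.tail ?_, ?_⟩, by simp_all; omega⟩
    · intro u hu w hw
      have hu' : f u = f τ := by
        by_contra hne
        have := h₁.2 ⟨_, hl₁.append_singleton hτ hu hne, rfl⟩
        simp at this; omega
      have hv' : f σ = f v := by
        by_contra hne
        have := h₂.2 ⟨_, hl₂.cons hσ (by simp) hne, rfl⟩
        simp at this hlen₂; omega
      refine ⟨(hl₁.2 u (List.mem_of_getLast? hu)).1.2.trans
        (hl₂.2 w (List.mem_cons_of_mem _ (List.mem_of_mem_head? hw))).1.1, ?_⟩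
      rw [hu', hτσ, hv']
      exact (hl₂.1.rel_head? hw).2
    · intro s hs
      rcases List.mem_append.1 hs with hs | hs
      · exact ⟨Set.Icc_subset_Icc_right hbc (hl₁.2 s hs).1, (hl₁.2 s hs).2⟩
      · have := hl₂.2 s (List.mem_cons_of_mem _ hs)
        exact ⟨Set.Icc_subset_Icc_left hab this.1, this.2⟩
  · rintro _ ⟨l, hl, rfl⟩
    obtain ⟨l₁, l₂, rfl, hle, hge⟩ := hl.pairwise_le.exists_append_of_le b
    have hl₁ : IsAltChain f G a b l₁ := by
      refine ⟨hl.1.left_of_append, fun s hs => ?_⟩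
      have := hl.2 s (List.mem_append_left _ hs)
      exact ⟨⟨this.1.1, hle s hs⟩, this.2⟩
    have hl₂ : IsAltChain f G b c l₂ := by
      refine ⟨hl.1.right_of_append, fun s hs => ?_⟩
      have := hl.2 s (List.mem_append_right _ hs)
      exact ⟨⟨hge s hs, this.1.2⟩, this.2⟩
    have hlen₁ := h₁.2 ⟨_, hl₁, rfl⟩
    have hlen₂ := h₂.2 ⟨_, hl₂, rfl⟩
    rw [List.length_append]
    rcases List.eq_nil_or_concat l₁ with rfl | ⟨l₁', u, hu⟩
    · simp; omega
    rcases l₂ with _ | ⟨v, l₂⟩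
    · simp; omega
    have hu' : u ∈ l₁.getLast? := by simp [hu]
    have huv : f u ≠ f v :=
      (List.isChain_append.1 hl.1).2.2 u hu' v (by simp) |>.2
    by_cases hne : f u = f τ
    · have := h₂.2 ⟨_, hl₂.cons (v := v) hσ (by simp) (by rwa [← hτσ, ← hne]), rfl⟩
      simp only [List.length_cons] at this ⊢
      omega
    · have := h₁.2 ⟨_, hl₁.append_singleton hτ hu' hne, rfl⟩
      simp only [List.length_append, List.length_singleton] at this
      omega

lemma isClosed_of_subset_peanoGrid {c r : ℝ} (hc : 0 < c) {T : Set ℝ} (hT : T ⊆ peanoGrid c r) :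
    IsClosed T := by
  have h : Topology.IsClosedEmbedding fun q : ℤ => c * (q : ℝ) + r :=
    ((Homeomorph.mulLeft₀ c hc.ne').trans (Homeomorph.addRight r)).isClosedEmbedding.comp
      Int.isClosedEmbedding_coe_real
  have hT' : T = (fun q : ℤ => c * (q : ℝ) + r) '' {q | c * (q : ℝ) + r ∈ T} := by
    ext u
    constructor
    · intro hu
      obtain ⟨q, rfl⟩ := hT hu
      exact ⟨q, hu, rfl⟩
    · rintro ⟨q, hq, rfl⟩
      exact hq
  rw [hT']
  exact h.isClosedMap _ (isClosed_discrete _)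

lemma exists_mem_peanoGrid {c : ℝ} (hc : 0 < c) (r a : ℝ) :
    ∃ u ∈ peanoGrid c r, u ∈ Set.Icc a (a + c) := by
  refine ⟨c * ⌈(a - r) / c⌉ + r, ⟨_, rfl⟩, ?_, ?_⟩
  · have := (div_le_iff₀' hc).1 (Int.le_ceil ((a - r) / c))
    linarith
  · have := mul_lt_mul_of_pos_left (Int.ceil_lt_add_one ((a - r) / c)) hc
    rw [mul_add, mul_div_cancel₀ _ hc.ne'] at this
    linarith

lemma le_dist_of_mem_peanoGrid {c r u v : ℝ} (hc : 0 < c) (hu : u ∈ peanoGrid c r)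
    (hv : v ∈ peanoGrid c r) (huv : u ≠ v) : c ≤ dist u v := by
  obtain ⟨p, rfl⟩ := hu
  obtain ⟨q, rfl⟩ := hv
  have hpq : p ≠ q := by rintro rfl; exact huv rfl
  have h1 : (1 : ℝ) ≤ |(p : ℝ) - q| := by
    exact_mod_cast Int.one_le_abs (sub_ne_zero.2 hpq)
  rw [Real.dist_eq, show c * (p : ℝ) + r - (c * q + r) = c * (p - q) by ring, abs_mul,
    abs_of_pos hc]
  nlinarith

lemma bddAbove_altLengths_peanoGrid {x : ℝ → ℝ} (hx : ContinuousOn x (Set.Icc 0 1)) {c r : ℝ}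
    (hc : 0 < c) : BddAbove (altLengths x (peanoGrid c r) 0 1) := by
  have huc := isCompact_Icc.uniformContinuousOn_of_continuous hx
  obtain ⟨δ, hδ, h⟩ := Metric.uniformContinuousOn_iff.1 huc c hc
  refine ⟨⌈1 / δ⌉₊ + 1, ?_⟩
  rintro _ ⟨l, hl, rfl⟩
  have key : ∀ i (hi : i < l.length), (i : ℝ) * δ ≤ l[i] := by
    intro i
    induction i with
    | zero => intro hi; simpa using (hl.2 _ (List.getElem_mem hi)).1.1
    | succ i ih =>
      intro hi
      have hs := hl.2 _ (List.getElem_mem (Nat.lt_of_succ_lt hi))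
      have ht := hl.2 _ (List.getElem_mem hi)
      have hst := List.isChain_iff_getElem.1 hl.1 i hi
      have hd : δ ≤ dist l[i] l[i + 1] := by
        by_contra! hlt
        exact (h _ hs.1 _ ht.1 hlt).not_ge (le_dist_of_mem_peanoGrid hc hs.2 ht.2 hst.2)
      rw [dist_comm, Real.dist_eq, abs_of_nonneg (sub_nonneg.2 hst.1)] at hd
      have := ih (Nat.lt_of_succ_lt hi)
      push_cast
      linarith
  rcases Nat.eq_zero_or_pos l.length with h0 | h0
  · omega
  obtain ⟨n, hn⟩ : ∃ n, l.length = n + 1 := ⟨l.length - 1, by omega⟩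
  have h1 := key n (by omega)
  have h2 := (hl.2 _ (List.getElem_mem (show n < l.length by omega))).1.2
  have h3 : (n : ℝ) ≤ 1 / δ := by rw [le_div_iff₀ hδ]; linarith
  have h4 : (n : ℝ) ≤ (⌈1 / δ⌉₊ : ℝ) := h3.trans (Nat.le_ceil _)
  have h5 : n ≤ ⌈1 / δ⌉₊ := by exact_mod_cast h4
  omega

lemma isClosed_setOf_mem_and_ne {x : ℝ → ℝ} (hx : ContinuousOn x (Set.Icc 0 1)) {c r a v : ℝ}
    (hc : 0 < c) (ha : 0 ≤ a) :
    IsClosed {t | t ∈ Set.Icc a 1 ∧ x t ∈ peanoGrid c r ∧ x t ≠ v} :=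
  (hx.mono (Set.Icc_subset_Icc_left ha)).preimage_isClosed_of_isClosed isClosed_Icc
    (isClosed_of_subset_peanoGrid (T := {u | u ∈ peanoGrid c r ∧ u ≠ v}) hc fun _ h => h.1)

lemma isCompact_setOf_mem_peanoGrid {x : ℝ → ℝ} (hx : ContinuousOn x (Set.Icc 0 1))
    {c r a b : ℝ} (hc : 0 < c) (ha : 0 ≤ a) (hb : b ≤ 1) :
    IsCompact {t | t ∈ Set.Icc a b ∧ x t ∈ peanoGrid c r} :=
  isCompact_Icc.of_isClosed_subset
    ((hx.mono (Set.Icc_subset_Icc ha hb)).preimage_isClosed_of_isClosed isClosed_Icc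
      (isClosed_of_subset_peanoGrid hc subset_rfl)) fun _ h => h.1

lemma IsLeast.sInf_toEReal_image {S : Set ℝ} {t : ℝ} (h : IsLeast S t) :
    sInf (Real.toEReal '' S) = t :=
  (EReal.coe_strictMono.monotone.map_isLeast h).isGLB.sInf_eq

lemma lebTime_zero_eq {x : ℝ → ℝ} {c r t : ℝ}
    (h : IsLeast {s | s ∈ Set.Icc (0 : ℝ) 1 ∧ x s ∈ peanoGrid c r} t) :
    lebTime x c r 0 = t := by
  rw [lebTime]
  exact h.sInf_toEReal_image

lemma lebTime_succ_eq {x : ℝ → ℝ} {c r s t : ℝ} {n : ℕ} (hs : lebTime x c r n = s)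
    (h : IsLeast {u | u ∈ Set.Icc s 1 ∧ x u ∈ peanoGrid c r ∧ x u ≠ x s} t) :
    lebTime x c r (n + 1) = t := by
  rw [lebTime, if_neg (by simp [hs]), hs, EReal.toReal_coe]
  exact h.sInf_toEReal_image

lemma lebTime_zero_eq_top_or {x : ℝ → ℝ} (hx : ContinuousOn x (Set.Icc 0 1)) {c r : ℝ}
    (hc : 0 < c) : lebTime x c r 0 = ⊤ ∨ ∃ t : ℝ, lebTime x c r 0 = t ∧
      IsLeast {s | s ∈ Set.Icc (0 : ℝ) 1 ∧ x s ∈ peanoGrid c r} t := by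
  rcases Set.eq_empty_or_nonempty {s | s ∈ Set.Icc (0 : ℝ) 1 ∧ x s ∈ peanoGrid c r} with h | h
  · left
    rw [lebTime, h, Set.image_empty, sInf_empty]
  · obtain ⟨t, ht⟩ := (isCompact_setOf_mem_peanoGrid hx hc le_rfl le_rfl).exists_isLeast h
    exact Or.inr ⟨t, lebTime_zero_eq ht, ht⟩

lemma lebTime_succ_eq_top_or {x : ℝ → ℝ} (hx : ContinuousOn x (Set.Icc 0 1)) {c r s : ℝ} {n : ℕ}
    (hc : 0 < c) (hs : lebTime x c r n = s) (hs0 : 0 ≤ s) :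
    lebTime x c r (n + 1) = ⊤ ∨ ∃ t : ℝ, lebTime x c r (n + 1) = t ∧
      IsLeast {u | u ∈ Set.Icc s 1 ∧ x u ∈ peanoGrid c r ∧ x u ≠ x s} t := by
  rcases Set.eq_empty_or_nonempty
    {u | u ∈ Set.Icc s 1 ∧ x u ∈ peanoGrid c r ∧ x u ≠ x s} with h | h
  · left
    rw [lebTime, if_neg (by simp [hs]), hs, EReal.toReal_coe, h, Set.image_empty, sInf_empty]
  · obtain ⟨t, ht⟩ := (isCompact_Icc.of_isClosed_subset
      (isClosed_setOf_mem_and_ne hx hc hs0) fun _ h => h.1).exists_isLeast h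
    exact Or.inr ⟨t, lebTime_succ_eq hs ht, ht⟩

lemma lebTime_eq_top_or {x : ℝ → ℝ} (hx : ContinuousOn x (Set.Icc 0 1)) {c r : ℝ}
    (hc : 0 < c) (n : ℕ) : lebTime x c r n = ⊤ ∨ ∃ t : ℝ, lebTime x c r n = t ∧
      t ∈ Set.Icc (0 : ℝ) 1 ∧ x t ∈ peanoGrid c r := by
  induction n with
  | zero =>
    exact (lebTime_zero_eq_top_or hx hc).imp_right fun ⟨t, ht, h⟩ => ⟨t, ht, h.1⟩
  | succ n ih =>
    rcases ih with h | ⟨s, hs, hs01, -⟩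
    · left
      rw [lebTime, if_pos h]
    · refine (lebTime_succ_eq_top_or hx hc hs hs01.1).imp_right fun ⟨t, ht, h⟩ =>
        ⟨t, ht, ⟨hs01.1.trans h.1.1.1, h.1.1.2⟩, h.1.2.1⟩

lemma lebTime_monotone {x : ℝ → ℝ} (hx : ContinuousOn x (Set.Icc 0 1)) {c r : ℝ}
    (hc : 0 < c) : Monotone (lebTime x c r) := by
  refine monotone_nat_of_le_succ fun n => ?_
  rcases lebTime_eq_top_or hx hc n (r := r) with h | ⟨s, hs, hs01, -⟩
  · rw [lebTime, if_pos h]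
    exact le_top
  · rcases lebTime_succ_eq_top_or hx hc hs hs01.1 with h | ⟨t, ht, h⟩
    · rw [h]
      exact le_top
    · rw [hs, ht]
      exact EReal.coe_le_coe h.1.1.1

lemma exists_lebTime_of_le {x : ℝ → ℝ} (hx : ContinuousOn x (Set.Icc 0 1)) {c r t : ℝ}
    (hc : 0 < c) {n : ℕ} (h : lebTime x c r n ≤ t) :
    ∃ s : ℝ, lebTime x c r n = s ∧ s ∈ Set.Icc 0 t ∧ s ≤ 1 ∧ x s ∈ peanoGrid c r := by
  rcases lebTime_eq_top_or hx hc n (r := r) with h' | ⟨s, hs, hs01, hG⟩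
  · rw [h', top_le_iff] at h
    exact absurd h (EReal.coe_ne_top t)
  · rw [hs, EReal.coe_le_coe_iff] at h
    exact ⟨s, hs, ⟨hs01.1, h⟩, hs01.2, hG⟩

lemma IsAltChain.lebTime_le_getElem {x : ℝ → ℝ} (hx : ContinuousOn x (Set.Icc 0 1)) {c r : ℝ}
    (hc : 0 < c) {l : List ℝ} (hl : IsAltChain x (peanoGrid c r) 0 1 l) (i : ℕ)
    (hi : i < l.length) : lebTime x c r i ≤ (l[i] : ℝ) := by
  induction i with
  | zero => exact sInf_le ⟨_, hl.2 _ (List.getElem_mem hi), rfl⟩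
  | succ i ih =>
    have hi' := Nat.lt_of_succ_lt hi
    have ht := hl.2 _ (List.getElem_mem hi)
    have hst := List.isChain_iff_getElem.1 hl.1 i hi
    obtain ⟨s, hs, hs0, hs1, -⟩ := exists_lebTime_of_le hx hc (ih hi')
    rw [lebTime, if_neg (by simp [hs]), hs, EReal.toReal_coe]
    by_cases hne : x l[i + 1] = x s
    · refine le_trans (sInf_le ⟨l[i], ⟨⟨hs0.2, ?_⟩, ?_, ?_⟩, rfl⟩) (EReal.coe_le_coe hst.1)
      · exact (hl.2 _ (List.getElem_mem hi')).1.2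
      · exact (hl.2 _ (List.getElem_mem hi')).2
      · rw [← hne]
        exact hst.2
    · exact sInf_le ⟨_, ⟨⟨hs0.2.trans hst.1, ht.1.2⟩, ht.2, hne⟩, rfl⟩

lemma succ_mem_altLengths_iff {x : ℝ → ℝ} (hx : ContinuousOn x (Set.Icc 0 1)) {c r t : ℝ}
    (hc : 0 < c) (ht : t ≤ 1) (n : ℕ) :
    n + 1 ∈ altLengths x (peanoGrid c r) 0 t ↔ lebTime x c r n ≤ t := by
  constructor
  · rintro ⟨l, hl, hlen⟩
    have hn : n < l.length := by omega
    have hl' : IsAltChain x (peanoGrid c r) 0 1 l :=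
      ⟨hl.1, fun s hs => ⟨Set.Icc_subset_Icc_right ht (hl.2 s hs).1, (hl.2 s hs).2⟩⟩
    exact (hl'.lebTime_le_getElem hx hc n hn).trans
      (EReal.coe_le_coe (hl.2 _ (List.getElem_mem hn)).1.2)
  · intro h
    refine ⟨(List.range (n + 1)).map fun i => (lebTime x c r i).toReal, ⟨?_, ?_⟩, by simp⟩
    · rw [List.isChain_map, List.isChain_range_succ]
      intro m hm
      have hm1 := (lebTime_monotone hx hc (Nat.succ_le_of_lt hm)).trans h
      have hm0 := (lebTime_monotone hx hc hm.le).trans h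
      obtain ⟨s, hs, hs0, -, -⟩ := exists_lebTime_of_le hx hc hm0
      rcases lebTime_succ_eq_top_or hx hc hs hs0.1 with h' | ⟨u, hu, h'⟩
      · rw [Nat.succ_eq_add_one, h', top_le_iff] at hm1
        exact absurd hm1 (EReal.coe_ne_top t)
      · rw [Nat.succ_eq_add_one, hu, hs, EReal.toReal_coe, EReal.toReal_coe]
        exact ⟨h'.1.1.1, h'.1.2.2.symm⟩
    · intro u hu
      obtain ⟨i, hi, rfl⟩ := List.mem_map.1 hu
      rw [List.mem_range] at hi
      obtain ⟨s, hs, hs0, -, hG⟩ :=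
        exists_lebTime_of_le hx hc ((lebTime_monotone hx hc (by omega : i ≤ n)).trans h)
      rw [hs, EReal.toReal_coe]
      exact ⟨hs0, hG⟩

lemma sub_sq_eq_of_isLeast {x : ℝ → ℝ} (hx : ContinuousOn x (Set.Icc 0 1)) {c r s t : ℝ}
    (hc : 0 < c) (hs0 : 0 ≤ s) (hs : x s ∈ peanoGrid c r)
    (h : IsLeast {u | u ∈ Set.Icc s 1 ∧ x u ∈ peanoGrid c r ∧ x u ≠ x s} t) :
    (x t - x s) ^ 2 = c ^ 2 := by
  obtain ⟨⟨⟨hst, ht1⟩, ht, hne⟩, hmin⟩ := h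
  obtain ⟨p, hp⟩ := hs
  obtain ⟨q, hq⟩ := ht
  have hcont : ContinuousOn x (Set.Icc s t) := hx.mono (Set.Icc_subset_Icc hs0 ht1)
  have hno : ∀ k : ℤ, c * k + r ∈ x '' Set.Icc s t → k = p ∨ k = q := by
    rintro k ⟨u, hu, hk⟩
    by_contra! hkne
    have hinj : ∀ m : ℤ, k ≠ m → c * (k : ℝ) + r ≠ c * m + r := fun m hm heq =>
      hm (by exact_mod_cast mul_left_cancel₀ hc.ne' (add_right_cancel heq))
    have htu : t ≤ u := hmin ⟨⟨hu.1, hu.2.trans ht1⟩, ⟨k, hk⟩, by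
      rw [hk, hp]; exact hinj p hkne.1⟩
    obtain rfl := le_antisymm hu.2 htu
    exact hinj q hkne.2 (hk.symm.trans hq)
  have hpq : p ≠ q := by
    rintro rfl
    exact hne (hq.trans hp.symm)
  have hstep : q = p + 1 ∨ q = p - 1 := by
    rcases lt_or_gt_of_ne hpq with hlt | hlt
    · left
      have := hno (p + 1) (intermediate_value_Icc hst hcont ⟨?_, ?_⟩)
      · omega
      · rw [hp]; push_cast; nlinarith
      · have : ((p + 1 : ℤ) : ℝ) ≤ q := by exact_mod_cast hlt
        rw [hq]; nlinarith
    · right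
      have := hno (p - 1) (intermediate_value_Icc' hst hcont ⟨?_, ?_⟩)
      · omega
      · have : (q : ℝ) ≤ ((p - 1 : ℤ) : ℝ) := by exact_mod_cast Int.le_sub_one_of_lt hlt
        rw [hq]; nlinarith
      · rw [hp]; push_cast; nlinarith
  rw [hp, hq]
  rcases hstep with rfl | rfl <;> push_cast <;> ring

lemma kIdx_zero {x : ℝ → ℝ} {c r : ℝ} : kIdx x c r 0 = 1 := by
  have h : IsLeast {m : ℕ | 1 ≤ m ∧ ((0 : ℝ) : EReal) ≤ lebTime x c r (m - 1)} 1 := by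
    refine ⟨⟨le_rfl, ?_⟩, fun m hm => hm.1⟩
    refine le_sInf ?_
    rintro _ ⟨t, ht, rfl⟩
    exact EReal.coe_le_coe ht.1.1
  exact h.csInf_eq

lemma lIdx_eq {x : ℝ → ℝ} (hx : ContinuousOn x (Set.Icc 0 1)) {c r t : ℝ} (hc : 0 < c)
    (ht : t ≤ 1) {N : ℕ} (hN : IsGreatest (altLengths x (peanoGrid c r) 0 t) (N + 1)) :
    lIdx x c r t = N + 1 := by
  have h : IsGreatest {m : ℕ | 1 ≤ m ∧ lebTime x c r (m - 1) ≤ (t : EReal)} (N + 1) := by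
    refine ⟨⟨by omega, (succ_mem_altLengths_iff hx hc ht N).1 hN.1⟩, ?_⟩
    rintro m ⟨hm, hle⟩
    have := hN.2 ((succ_mem_altLengths_iff hx hc ht (m - 1)).2 hle)
    omega
  exact h.csSup_eq

/-- The quadratic variation is `c ^ 2` times the maximal number of changes of grid value. -/
lemma qvar0_eq {x : ℝ → ℝ} (hx : ContinuousOn x (Set.Icc 0 1)) {c r t : ℝ} (hc : 0 < c)
    (ht : t ≤ 1) {N : ℕ} (hN : IsGreatest (altLengths x (peanoGrid c r) 0 t) (N + 1)) :
    qvar0 x c r t = N * c ^ 2 := by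
  rw [qvar0, qvar, kIdx_zero, lIdx_eq hx hc ht hN,
    Finset.sum_congr rfl (g := fun _ => c ^ 2), Finset.sum_const, Nat.card_Ico,
    Nat.add_sub_cancel, nsmul_eq_mul]
  intro m hm
  obtain ⟨n, rfl⟩ : ∃ n, m = n + 1 := ⟨m - 1, by have := (Finset.mem_Ico.1 hm).1; omega⟩
  have hn : n + 1 ≤ N := by have := (Finset.mem_Ico.1 hm).2; omega
  have hlast := (succ_mem_altLengths_iff hx hc ht N).1 hN.1
  have h1 := (lebTime_monotone hx hc hn).trans hlast
  obtain ⟨s, hs, hs0, -, hG⟩ :=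
    exists_lebTime_of_le hx hc ((lebTime_monotone hx hc n.le_succ).trans h1)
  rw [Nat.add_sub_cancel, hs, EReal.toReal_coe]
  rcases lebTime_succ_eq_top_or hx hc hs hs0.1 with h' | ⟨u, hu, h'⟩
  · rw [h', top_le_iff] at h1
    exact absurd h1 (EReal.coe_ne_top t)
  · rw [hu, EReal.toReal_coe]
    exact sub_sq_eq_of_isLeast hx hc hs0.1 hG h'

lemma mem_peanoGrid_div_three_iff {c r u : ℝ} :
    u / 3 ∈ peanoGrid c r ↔ u ∈ peanoGrid (3 * c) (3 * r) := by
  refine exists_congr fun q => ?_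
  constructor <;> intro h <;> linarith

lemma IsPeanoX.altLengths_first_ninth {x : ℝ → ℝ} (hx : IsPeanoX x) (c r : ℝ) :
    altLengths x (peanoGrid c r) 0 (1 / 9) = altLengths x (peanoGrid (3 * c) (3 * r)) 0 1 := by
  have h9 : ∀ s ∈ Set.Icc (0 : ℝ) (1 / 9),
      s * 9 ∈ Set.Icc (0 : ℝ) 1 ∧ x (s * 9) / 3 = x s := by
    rintro s ⟨h0, h1⟩
    have hs : s * 9 ∈ Set.Icc (0 : ℝ) 1 := ⟨by linarith, by linarith⟩
    refine ⟨hs, ?_⟩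
    rw [← hx.apply_div_nine hs, mul_div_cancel_right₀ _ (by norm_num)]
  apply Set.Subset.antisymm
  · refine altLengths_subset_of_monotoneOn (φ := fun s => s * 9)
      (fun s _ t _ h => by simpa using h) (fun s hs hG => ⟨(h9 s hs).1, ?_⟩)
      fun s hs t ht hne heq => hne ?_
    · rwa [← mem_peanoGrid_div_three_iff, (h9 s hs).2]
    · rw [← (h9 s hs).2, ← (h9 t ht).2, heq]
  · refine altLengths_subset_of_monotoneOn (φ := fun s => s / 9)
      (fun s _ t _ h => by simpa using (div_le_div_of_nonneg_right h (by norm_num)))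
      (fun s hs hG => ⟨⟨?_, ?_⟩, ?_⟩) fun s hs t ht hne heq => hne ?_
    · linarith [hs.1]
    · linarith [hs.2]
    · rwa [hx.apply_div_nine hs, mem_peanoGrid_div_three_iff]
    · simp only [hx.apply_div_nine hs, hx.apply_div_nine ht] at heq
      linarith

lemma IsPeanoX.altLengths_second_ninth {x : ℝ → ℝ} (hx : IsPeanoX x) (G : Set ℝ) :
    altLengths x G (1 / 9) (2 / 9) = altLengths x G 0 (1 / 9) := by
  have h : ∀ s ∈ Set.Icc (1 / 9 : ℝ) (2 / 9), 2 / 9 - s ∈ Set.Icc (0 : ℝ) (1 / 9) ∧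
      x (2 / 9 - s) = x s := by
    rintro s ⟨h0, h1⟩
    have hs : 2 / 9 - s ∈ Set.Icc (0 : ℝ) (1 / 9) := ⟨by linarith, by linarith⟩
    exact ⟨hs, by simpa using (hx.apply_two_ninths_sub hs).symm⟩
  apply Set.Subset.antisymm
  · refine altLengths_subset_of_antitoneOn (φ := fun s => 2 / 9 - s)
      (fun s _ t _ h => sub_le_sub_left h _) (fun s hs hG => ⟨(h s hs).1, ?_⟩)
      fun s hs t ht hne => ?_
    · rwa [(h s hs).2]
    · rwa [(h s hs).2, (h t ht).2]
  · refine altLengths_subset_of_antitoneOn (φ := fun s => 2 / 9 - s)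
      (fun s _ t _ h => sub_le_sub_left h _) (fun s hs hG => ⟨⟨?_, ?_⟩, ?_⟩)
      fun s hs t ht hne => ?_
    · linarith [hs.2]
    · linarith [hs.1]
    · rwa [hx.apply_two_ninths_sub hs]
    · rwa [hx.apply_two_ninths_sub hs, hx.apply_two_ninths_sub ht]

lemma IsPeanoX.altLengths_third_ninth {x : ℝ → ℝ} (hx : IsPeanoX x) (G : Set ℝ) :
    altLengths x G (2 / 9) (3 / 9) = altLengths x G 0 (1 / 9) := by
  have h : ∀ s ∈ Set.Icc (2 / 9 : ℝ) (3 / 9), s - 2 / 9 ∈ Set.Icc (0 : ℝ) (1 / 9) ∧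
      x (s - 2 / 9) = x s := by
    rintro s ⟨h0, h1⟩
    have hs : s - 2 / 9 ∈ Set.Icc (0 : ℝ) (1 / 9) := ⟨by linarith, by linarith⟩
    exact ⟨hs, by simpa using (hx.apply_two_ninths_add hs).symm⟩
  apply Set.Subset.antisymm
  · refine altLengths_subset_of_monotoneOn (φ := fun s => s - 2 / 9)
      (fun s _ t _ h => by simpa using h) (fun s hs hG => ⟨(h s hs).1, ?_⟩)
      fun s hs t ht hne => ?_
    · rwa [(h s hs).2]
    · rwa [(h s hs).2, (h t ht).2]
  · refine altLengths_subset_of_monotoneOn (φ := fun s => s + 2 / 9)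
      (fun s _ t _ h => by simpa using h) (fun s hs hG => ⟨⟨?_, ?_⟩, ?_⟩)
      fun s hs t ht hne => ?_
    · linarith [hs.1]
    · linarith [hs.2]
    · rwa [hx.apply_two_ninths_add hs]
    · rwa [hx.apply_two_ninths_add hs, hx.apply_two_ninths_add ht]

lemma IsPeanoX.isGreatest_altLengths_two_ninths {x : ℝ → ℝ} (hx : IsPeanoX x) {G : Set ℝ}
    {τ : ℝ} (hτ : IsGreatest {s | s ∈ Set.Icc (0 : ℝ) (1 / 9) ∧ x s ∈ G} τ) {N : ℕ}
    (hN : IsGreatest (altLengths x G 0 (1 / 9)) (N + 1)) :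
    IsGreatest (altLengths x G 0 (2 / 9)) (N + N + 1) := by
  have hx2 := hx.apply_two_ninths_sub hτ.1.1
  refine isGreatest_altLengths_add (b := 1 / 9) (by norm_num) (by norm_num) hτ (σ := 2 / 9 - τ)
    ⟨⟨⟨?_, ?_⟩, ?_⟩, ?_⟩ hx2.symm hN (hx.altLengths_second_ninth G ▸ hN)
  · linarith [hτ.1.1.2]
  · linarith [hτ.1.1.1]
  · rw [hx2]
    exact hτ.1.2
  · rintro s ⟨⟨h0, h1⟩, hG⟩
    have hs : 2 / 9 - s ∈ Set.Icc (0 : ℝ) (1 / 9) := ⟨by linarith, by linarith⟩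
    have := hτ.2 ⟨hs, by rw [← hx.apply_two_ninths_sub hs, sub_sub_cancel]; exact hG⟩
    linarith

lemma IsPeanoX.isGreatest_altLengths_three_ninths {x : ℝ → ℝ} (hx : IsPeanoX x) {G : Set ℝ}
    {τ σ : ℝ} (hτ : IsGreatest {s | s ∈ Set.Icc (0 : ℝ) (1 / 9) ∧ x s ∈ G} τ)
    (hσ : IsLeast {s | s ∈ Set.Icc (0 : ℝ) (1 / 9) ∧ x s ∈ G} σ) {N : ℕ}
    (hN : IsGreatest (altLengths x G 0 (1 / 9)) (N + 1)) :
    IsGreatest (altLengths x G 0 (3 / 9)) (N + N + N + 1) := by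
  have hsub := hx.apply_two_ninths_sub hσ.1.1
  have hadd := hx.apply_two_ninths_add hσ.1.1
  have h0 := hσ.1.1.1
  have h1 := hσ.1.1.2
  refine isGreatest_altLengths_add (b := 2 / 9) (by norm_num) (by norm_num) (τ := 2 / 9 - σ)
    (σ := σ + 2 / 9) ⟨⟨⟨by linarith, by linarith⟩, ?_⟩, ?_⟩
    ⟨⟨⟨by linarith, by linarith⟩, ?_⟩, ?_⟩ (hsub.trans hadd.symm)
    (hx.isGreatest_altLengths_two_ninths hτ hN) (hx.altLengths_third_ninth G ▸ hN)
  · rw [hsub]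
    exact hσ.1.2
  · rintro s ⟨⟨hs0, hs1⟩, hG⟩
    by_cases h9 : s ≤ 1 / 9
    · linarith
    · have hs : 2 / 9 - s ∈ Set.Icc (0 : ℝ) (1 / 9) := ⟨by linarith, by linarith⟩
      have := hσ.2 ⟨hs, by rw [← hx.apply_two_ninths_sub hs, sub_sub_cancel]; exact hG⟩
      linarith
  · rw [hadd]
    exact hσ.1.2
  · rintro s ⟨⟨hs0, hs1⟩, hG⟩
    have hs : s - 2 / 9 ∈ Set.Icc (0 : ℝ) (1 / 9) := ⟨by linarith, by linarith⟩
    have := hσ.2 ⟨hs, by rw [← hx.apply_two_ninths_add hs, sub_add_cancel]; exact hG⟩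
    linarith

/-- `[x]_{1/9}^{c,r} = [x]_{2/9}^{c,r} - [x]_{1/9}^{c,r} = [x]_{3/9}^{c,r} - [x]_{2/9}^{c,r}
= (1/9)[x]_1^{3c,3r}` for the horizontal component of the Peano curve. -/
theorem peano_first_three_ninths (x : ℝ → ℝ) (hx : IsPeanoX x)
    (c r : ℝ) (hc : c ∈ Set.Ioc (0 : ℝ) (1 / 3)) :
    qvar0 x c r (1 / 9) = 1 / 9 * qvar0 x (3 * c) (3 * r) 1 ∧
    qvar0 x c r (2 / 9) - qvar0 x c r (1 / 9) = 1 / 9 * qvar0 x (3 * c) (3 * r) 1 ∧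
    qvar0 x c r (3 / 9) - qvar0 x c r (2 / 9) = 1 / 9 * qvar0 x (3 * c) (3 * r) 1 := by
  obtain ⟨hc0, hc1⟩ := hc
  have hcont := hx.continuousOn
  have hhit : {s | s ∈ Set.Icc (0 : ℝ) (1 / 9) ∧ x s ∈ peanoGrid c r}.Nonempty := by
    obtain ⟨u, hu, hu0, hu1⟩ := exists_mem_peanoGrid hc0 r 0
    obtain ⟨s, hs, rfl⟩ := intermediate_value_Icc (by norm_num : (0 : ℝ) ≤ 1 / 9)
      (hcont.mono (Set.Icc_subset_Icc_right (by norm_num)))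
      (show u ∈ Set.Icc (x 0) (x (1 / 9)) by
        rw [hx.apply_zero, hx.apply_one_ninth]
        exact ⟨hu0, by linarith⟩)
    exact ⟨s, hs, hu⟩
  have hcomp : IsCompact {s | s ∈ Set.Icc (0 : ℝ) (1 / 9) ∧ x s ∈ peanoGrid c r} :=
    isCompact_setOf_mem_peanoGrid hcont hc0 le_rfl (by norm_num)
  obtain ⟨τ, hτ⟩ := hcomp.exists_isGreatest hhit
  obtain ⟨σ, hσ⟩ := hcomp.exists_isLeast hhit
  have hscale := hx.altLengths_first_ninth c r
  have hone : 1 ∈ altLengths x (peanoGrid c r) 0 (1 / 9) :=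
    ⟨[τ], ⟨List.isChain_singleton _, by simpa using hτ.1⟩, rfl⟩
  obtain ⟨N, hN⟩ : ∃ N, IsGreatest (altLengths x (peanoGrid c r) 0 (1 / 9)) (N + 1) := by
    have hbdd : BddAbove (altLengths x (peanoGrid c r) 0 (1 / 9)) :=
      hscale ▸ bddAbove_altLengths_peanoGrid hcont (by positivity)
    have hmax : IsGreatest (altLengths x (peanoGrid c r) 0 (1 / 9)) _ :=
      ⟨Nat.sSup_mem ⟨1, hone⟩ hbdd, fun _ h => le_csSup hbdd h⟩
    obtain ⟨N, hN⟩ := Nat.exists_eq_add_of_le' (hmax.2 hone)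
    exact ⟨N, hN ▸ hmax⟩
  rw [qvar0_eq hcont hc0 (by norm_num) hN,
    qvar0_eq hcont hc0 (by norm_num) (hx.isGreatest_altLengths_two_ninths hτ hN),
    qvar0_eq hcont hc0 (by norm_num) (hx.isGreatest_altLengths_three_ninths hτ hσ hN),
    qvar0_eq hcont (by positivity) le_rfl (hscale ▸ hN)]
  push_cast
  refine ⟨?_, ?_, ?_⟩ <;> ring
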